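/- The set (M \ L) ∩ (c_inf, C_inf) has a smallest element, and this smallest element equals f := [overline(2_4 1_2 2_2 1)] + [0; 1, 2_2, 1_2, 2_4, 1, 2_2, 1_2, 2_2, 1_2, overline(2_3 1_3)] (approximately 3.11812017815984). -/

import Mathlib

open Filter Set

/-- Convergents of the continued fraction `[a 0; a 1, a 2, ...]`. -/
noncomputable def cfConv : (ℕ → ℕ) → ℕ → ℝ
  | a, 0 => (a 0 : ℝ)
  | a, n + 1 => (a 0 : ℝ) + 1 / cfConv (fun i => a (i + 1)) n

/-- Value of the infinite continued fraction `[a 0; a 1, a 2, ...]`,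
i.e. the limit of its convergents. -/
noncomputable def cfVal (a : ℕ → ℕ) : ℝ := limUnder atTop (cfConv a)

/-- Value of the infinite continued fraction `[0; g 0, g 1, g 2, ...]`. -/
noncomputable def cf0 (g : ℕ → ℕ) : ℝ :=
  cfVal (fun n => match n with | 0 => 0 | k + 1 => g k)

/-- `λ_i(A) = [a_i; a_{i+1}, ...] + [0; a_{i-1}, a_{i-2}, ...]` for a bi-infinite
sequence `A`. -/
noncomputable def lam (A : ℤ → ℕ) (i : ℤ) : ℝ :=
  cfVal (fun n => A (i + n)) + cf0 (fun k => A (i - 1 - k))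

/-- The Markov value `m(A) = sup_i λ_i(A)`. -/
noncomputable def markovVal (A : ℤ → ℕ) : ℝ := sSup (Set.range (lam A))

/-- The Lagrange value `ℓ(A) = limsup_{i → +∞} λ_i(A)`. -/
noncomputable def lagrangeVal (A : ℤ → ℕ) : ℝ := limsup (lam A) atTop

/-- The Markov spectrum (Perron's characterization). -/
def MarkovSpectrum : Set ℝ :=
  {x | ∃ A : ℤ → ℕ, (∀ n, 0 < A n) ∧ BddAbove (Set.range (lam A)) ∧ x = markovVal A}

/-- The Lagrange spectrum (Perron's characterization). -/
def LagrangeSpectrum : Set ℝ :=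
  {x | ∃ A : ℤ → ℕ, (∀ n, 0 < A n) ∧ IsBoundedUnder (· ≤ ·) atTop (lam A) ∧
    x = lagrangeVal A}

/-- The purely periodic one-sided sequence with period `w`. -/
def perSeq (w : List ℕ) : ℕ → ℕ := fun n => w.getD (n % w.length) 1

/-- The one-sided sequence beginning with the finite word `p` and continuing with `g`. -/
def catSeq (p : List ℕ) (g : ℕ → ℕ) : ℕ → ℕ :=
  fun n => if n < p.length then p.getD n 1 else g (n - p.length)

/-- The eventually periodic one-sided sequence with preperiod `p` and period `w`. -/
def prePer (p w : List ℕ) : ℕ → ℕ := catSeq p (perSeq w)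

/-- The periodic bi-infinite sequence with period `w`. -/
def perZ (w : List ℕ) : ℤ → ℕ := fun n => w.getD ((n % (w.length : ℤ)).toNat) 1

/-- `c_∞ = [overline(2_4 1_2 2_2 1)] + [0; overline(1 2_2 1_2 2_4)]`. -/
noncomputable def cInf : ℝ :=
  cfVal (perSeq [2,2,2,2,1,1,2,2,1]) + cf0 (perSeq [1,2,2,1,1,2,2,2,2])

/-- `C_∞ = [2; 1, 2_2, 1_2, 2_4, 1, 2_2, 1_2, 2_4, 1, 2_2, 1_2, 2_2, 1, 2_4, 1_2,
overline(2_3 1_3)] + [0; 2_3, 1_2, 2_2, 1, 2_4, 1, overline(1_3 2_3)]`. -/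
noncomputable def CInf : ℝ :=
  cfVal (prePer [2,1,2,2,1,1,2,2,2,2,1,2,2,1,1,2,2,2,2,1,2,2,1,1,2,2,1,2,2,2,2,1,1]
    [2,2,2,1,1,1]) +
  cf0 (prePer [2,2,2,1,1,2,2,1,2,2,2,2,1] [1,1,1,2,2,2])

/-- `f = [overline(2_4 1_2 2_2 1)] + [0; 1, 2_2, 1_2, 2_4, 1, 2_2, 1_2, 2_2, 1_2,
overline(2_3 1_3)]`. -/
noncomputable def fV : ℝ :=
  cfVal (perSeq [2,2,2,2,1,1,2,2,1]) +
  cf0 (prePer [1,2,2,1,1,2,2,2,2,1,2,2,1,1,2,2,1,1] [2,2,2,1,1,1])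

/-- `w` occurs in the bi-infinite sequence `A` starting at position `j`. -/
def occursAtZ (w : List ℕ) (A : ℤ → ℕ) (j : ℤ) : Prop :=
  ∀ i : ℕ, i < w.length → A (j + i) = w.getD i 0

/-- `w` occurs somewhere in the bi-infinite sequence `A`. -/
def occursInZ (w : List ℕ) (A : ℤ → ℕ) : Prop := ∃ j : ℤ, occursAtZ w A j

/-- `w` occurs in the one-sided sequence `g` starting at position `k`. -/
def occursAtN (w : List ℕ) (g : ℕ → ℕ) (k : ℕ) : Prop :=
  ∀ i : ℕ, i < w.length → g (k + i) = w.getD i 0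

/-- `w` occurs somewhere in the one-sided sequence `g`. -/
def occursInN (w : List ℕ) (g : ℕ → ℕ) : Prop := ∃ k : ℕ, occursAtN w g k

def W1 : List ℕ := [1,2,1]
def W2 : List ℕ := [2,2,1,2,2,2,1]
def W3 : List ℕ := [2,2,2,1,2,2,2]
def W4 : List ℕ := [2,2,2,2,2,1,2,2,1,1]
def W5 : List ℕ := [2,2,2,1,1,2,2,2,2,1,2,2,1,1,2,2,2]
def W6 : List ℕ := [2,2,1,1,2,2,2,2,1,2,2,1,1,2,2,2,1]
def W7 : List ℕ := [1,1,2,2,1,1,2,2,2,2,1,2,2,1,1,2,2,2]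
def W8 : List ℕ := [2,2,1,2,2,1,1,2,2,2,2,1,2,2,1,1,2,2,2,2,2]
def W9 : List ℕ := [1,2,2,1,2,2,1,1,2,2,2,2,1,2,2,1,1,2,2,2,2,1]
def W10 : List ℕ := [2,2,2,2,1,2,2,1,1,2,2,2,2,1,2,2,1,1,2,2,2,2,1,1]
def W11 : List ℕ := [2,2,2,2,1,2,2,1,1,2,2,2,2,1,2,2,1,1,2,2,2,2,1,2,2,1,2]
def W12 : List ℕ := [1,2,2,2,2,1,2,2,1,1,2,2,2,2,1,2,2,1,1,2,2,2,2,1,2,2,1,1,1]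
def W13 : List ℕ := [2,1,2,2,2,2,1,2,2,1,1,2,2,2,2,1,2,2,1,1,2,2,2,2,1,2,2,1,1,2,2]

/-- The list of the thirteen words `W_1, …, W_13`. -/
def Wall : List (List ℕ) := [W1,W2,W3,W4,W5,W6,W7,W8,W9,W10,W11,W12,W13]

/-- The words `W_1, …, W_13` together with the (0-based) position of their marked
digit `2^*`. -/
def markedW : List (List ℕ × ℕ) :=
  [(W1,1),(W2,3),(W3,4),(W4,4),(W5,8),(W6,7),(W7,9),(W8,10),(W9,11),(W10,12),
   (W11,12),(W12,13),(W13,14)]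

/-- The words `V_15, …, V_21` together with the (0-based) position of their marked
digit `2^*`. -/
def markedV : List (List ℕ × ℕ) :=
  [([1,1,2,2],2),
   ([2,2,1,2,2,1],3),
   ([2,2,2,2,1,2,2,1,2],3),
   ([1,2,2,2,2,1,2,2,1,1,1],4),
   ([1,2,2,2,2,1,2,2,1,1,2,2,1],4),
   ([2,1,2,2,2,2,1,2,2,1,1,2,2,2],5),
   ([1,1,1,2,2,2,2,1,2,2,1,1,2,2,2],6)]

/-- The word `2 1_2 2_4 1 2_2 1_2 2_3`. -/
def spWord : List ℕ := [2,1,1,2,2,2,2,1,2,2,1,1,2,2,2]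

/-- The set `P` of 27 forbidden words: `W_1, …, W_13`, their transposes, and
`2 1_2 2_4 1 2_2 1_2 2_3` together with its transpose. -/
def Pwords : List (List ℕ) := Wall ++ Wall.map List.reverse ++ [spWord, spWord.reverse]

/-- `g` contains no word of `P` as a consecutive subword. -/
def avoidsP (g : ℕ → ℕ) : Prop := ∀ w ∈ Pwords, ¬ occursInN w g

/-- The Cantor set `Y`. -/
noncomputable def Yset : Set ℝ :=
  {x | ∃ g : ℕ → ℕ, (∀ n, g n = 1 ∨ g n = 2) ∧ avoidsP g ∧ x = cf0 g}

/-- The word `1_2 2_4 1 2_2 1_2 2_4 1 2_2 1_2 2_4 1 2_2 1_2 2_2`. -/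
def bigWord : List ℕ :=
  [1,1,2,2,2,2,1,2,2,1,1,2,2,2,2,1,2,2,1,1,2,2,2,2,1,2,2,1,1,2,2]

/-- The word `1_3 2_4 1 2_2 1_2 2_4 1 2_2 1_2 2_4 1 2_2 1_2 2_2`. -/
def bigWord13 : List ℕ := 1 :: bigWord

/-- `g` is an infinite concatenation of the blocks `(1,1)` and `(2,2)`. -/
def isBlockSeq (g : ℕ → ℕ) : Prop :=
  ∀ n, (g (2*n) = 1 ∧ g (2*n+1) = 1) ∨ (g (2*n) = 2 ∧ g (2*n+1) = 2)

/-- The Gauss–Cantor set `K({1_2, 2_2})`. -/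
noncomputable def Kset : Set ℝ := {x | ∃ g : ℕ → ℕ, isBlockSeq g ∧ x = cf0 g}

theorem one_le_cfConv {a : ℕ → ℕ} (ha : ∀ n, 0 < a n) (n : ℕ) : 1 ≤ cfConv a n := by
  induction n generalizing a with
  | zero => simpa [cfConv] using Nat.one_le_iff_ne_zero.2 (ha 0).ne'
  | succ n ih =>
    have h := ih (a := fun i => a (i + 1)) fun i => ha _
    have h0 : (1 : ℝ) ≤ a 0 := by exact_mod_cast ha 0
    have : 0 < 1 / cfConv (fun i => a (i + 1)) n := by positivity
    simp only [cfConv]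
    linarith

theorem cfConv_mem_Icc {a : ℕ → ℕ} (ha : ∀ n, 0 < a n) (n : ℕ) :
    cfConv a n ∈ Icc (a 0 : ℝ) (a 0 + 1) := by
  cases n with
  | zero => simp [cfConv]
  | succ n =>
    have h := one_le_cfConv (a := fun i => a (i + 1)) (fun i => ha _) n
    have h1 : 0 < 1 / cfConv (fun i => a (i + 1)) n := by positivity
    have h2 : 1 / cfConv (fun i => a (i + 1)) n ≤ 1 := by
      rw [div_le_one (by linarith)]
      exact h
    simp only [cfConv]
    constructor <;> linarith

/-- Two continued fraction steps contract distances by a factor of at least four. -/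
theorem abs_two_step_sub_le {b x y : ℝ} (hb : 1 ≤ b) (hx : 1 ≤ x) (hy : 1 ≤ y) :
    |1 / (b + 1 / x) - 1 / (b + 1 / y)| ≤ |x - y| / 4 := by
  have hx0 : 0 < x := by linarith
  have hy0 : 0 < y := by linarith
  have hbx : 1 ≤ b * x := one_le_mul_of_one_le_of_one_le hb hx
  have hby : 1 ≤ b * y := one_le_mul_of_one_le_of_one_le hb hy
  have e : 1 / (b + 1 / x) - 1 / (b + 1 / y) = (x - y) / ((b * x + 1) * (b * y + 1)) := by
    have : b * x + 1 ≠ 0 := by positivity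
    have : b * y + 1 ≠ 0 := by positivity
    field_simp
    ring
  rw [e, abs_div, abs_of_pos (a := (b * x + 1) * (b * y + 1)) (by positivity)]
  gcongr
  nlinarith

theorem abs_cfConv_sub_le (k : ℕ) {a : ℕ → ℕ} (ha : ∀ n, 0 < a n) {n m : ℕ}
    (hn : 2 * k ≤ n) (hm : 2 * k ≤ m) : |cfConv a n - cfConv a m| ≤ (1 / 4) ^ k := by
  induction k generalizing a n m with
  | zero =>
    have h1 := cfConv_mem_Icc ha n
    have h2 := cfConv_mem_Icc ha m
    rw [pow_zero, abs_le]
    constructor <;> linarith [h1.1, h1.2, h2.1, h2.2]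
  | succ k ih =>
    obtain ⟨n, rfl⟩ : ∃ n', n = n' + 2 := ⟨n - 2, by omega⟩
    obtain ⟨m, rfl⟩ : ∃ m', m = m' + 2 := ⟨m - 2, by omega⟩
    have hpos : ∀ i, 0 < (fun i => a (i + 1 + 1)) i := fun i => ha _
    have h := ih (a := fun i => a (i + 1 + 1)) hpos (n := n) (m := m) (by omega) (by omega)
    have hb : (1 : ℝ) ≤ a (0 + 1) := by exact_mod_cast ha _
    have h4 := abs_two_step_sub_le hb (one_le_cfConv hpos n) (one_le_cfConv hpos m)
    simp only [cfConv, add_sub_add_left_eq_sub]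
    refine h4.trans ?_
    rw [pow_succ]
    linarith

theorem tendsto_cfConv {a : ℕ → ℕ} (ha : ∀ n, 0 < a n) :
    Tendsto (cfConv a) atTop (nhds (cfVal a)) := by
  have hc : CauchySeq (cfConv a) := by
    rw [Metric.cauchySeq_iff]
    intro ε hε
    obtain ⟨k, hk⟩ := exists_pow_lt_of_lt_one hε (by norm_num : (1 / 4 : ℝ) < 1)
    refine ⟨2 * k, fun m hm n hn => ?_⟩
    rw [Real.dist_eq]
    exact (abs_cfConv_sub_le k ha hm hn).trans_lt hk
  exact tendsto_nhds_limUnder (cauchySeq_tendsto_of_complete hc)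

theorem one_le_cfVal {a : ℕ → ℕ} (ha : ∀ n, 0 < a n) : 1 ≤ cfVal a :=
  ge_of_tendsto' (tendsto_cfConv ha) (one_le_cfConv ha)

theorem cfVal_eq_add_inv {a : ℕ → ℕ} (ha : ∀ n, 0 < a (n + 1)) :
    cfVal a = a 0 + 1 / cfVal (fun i => a (i + 1)) := by
  have h1 := tendsto_cfConv ha
  have h2 : (0 : ℝ) < cfVal (fun i => a (i + 1)) := by linarith [one_le_cfVal ha]
  have h3 : Tendsto (fun n => cfConv a (n + 1)) atTop
      (nhds (a 0 + 1 / cfVal (fun i => a (i + 1)))) := by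
    simp only [cfConv]
    exact tendsto_const_nhds.add (tendsto_const_nhds.div h1 h2.ne')
  exact ((tendsto_add_atTop_iff_nat 1).1 h3).limUnder_eq

theorem cf0_eq_inv_cfVal {g : ℕ → ℕ} (hg : ∀ n, 0 < g n) : cf0 g = 1 / cfVal g := by
  unfold cf0
  rw [cfVal_eq_add_inv (by simpa using hg)]
  simp

theorem cfVal_eq_add_cf0 {a : ℕ → ℕ} (ha : ∀ n, 0 < a n) :
    cfVal a = a 0 + cf0 (fun i => a (i + 1)) := by
  rw [cfVal_eq_add_inv fun n => ha _, cf0_eq_inv_cfVal fun n => ha _]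

theorem cf0_eq {g : ℕ → ℕ} (hg : ∀ n, 0 < g n) :
    cf0 g = 1 / (g 0 + cf0 (fun i => g (i + 1))) := by
  rw [cf0_eq_inv_cfVal hg, cfVal_eq_add_cf0 hg]

theorem cf0_nonneg {g : ℕ → ℕ} (hg : ∀ n, 0 < g n) : 0 ≤ cf0 g := by
  rw [cf0_eq_inv_cfVal hg]
  have := one_le_cfVal hg
  positivity

theorem cf0_le_one {g : ℕ → ℕ} (hg : ∀ n, 0 < g n) : cf0 g ≤ 1 := by
  have := one_le_cfVal hg
  rw [cf0_eq_inv_cfVal hg, div_le_one (by linarith)]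
  exact this

/-- The value `[0; A s, A (s + 1), ...]`. -/
noncomputable def rightVal (A : ℤ → ℕ) (s : ℤ) : ℝ := cf0 fun k => A (s + k)

/-- The value `[0; A s, A (s - 1), ...]`. -/
noncomputable def leftVal (A : ℤ → ℕ) (s : ℤ) : ℝ := cf0 fun k => A (s - k)

section
variable {A B : ℤ → ℕ}

theorem rightVal_eq (hA : ∀ n, 0 < A n) (s : ℤ) :
    rightVal A s = 1 / (A s + rightVal A (s + 1)) := by
  unfold rightVal
  rw [cf0_eq fun n => hA _]
  simp [add_comm, add_left_comm]

theorem leftVal_eq (hA : ∀ n, 0 < A n) (s : ℤ) :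
    leftVal A s = 1 / (A s + leftVal A (s - 1)) := by
  unfold leftVal
  rw [cf0_eq fun n => hA _]
  simp [sub_sub, add_comm]

theorem lam_eq (hA : ∀ n, 0 < A n) (s : ℤ) :
    lam A s = A s + rightVal A (s + 1) + leftVal A (s - 1) := by
  unfold lam rightVal leftVal
  rw [cfVal_eq_add_cf0 fun n => hA _]
  simp [add_comm, add_left_comm]

theorem rightVal_mem (hA : ∀ n, 0 < A n) (s : ℤ) : 0 ≤ rightVal A s ∧ rightVal A s ≤ 1 :=
  ⟨cf0_nonneg fun _ => hA _, cf0_le_one fun _ => hA _⟩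

theorem leftVal_mem (hA : ∀ n, 0 < A n) (s : ℤ) : 0 ≤ leftVal A s ∧ leftVal A s ≤ 1 :=
  ⟨cf0_nonneg fun _ => hA _, cf0_le_one fun _ => hA _⟩

theorem lam_shift (A : ℤ → ℕ) (o s : ℤ) : lam (fun n => A (o + n)) s = lam A (o + s) := by
  unfold lam
  simp [add_sub_assoc, add_assoc]

theorem lam_neg (hA : ∀ n, 0 < A n) (s : ℤ) : lam (fun n => A (-n)) s = lam A (-s) := by
  have hr : rightVal (fun n => A (-n)) (s + 1) = leftVal A (-s - 1) := by
    unfold rightVal leftVal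
    exact congrArg cf0 (funext fun k => congrArg A (by ring))
  have hl : leftVal (fun n => A (-n)) (s - 1) = rightVal A (-s + 1) := by
    unfold rightVal leftVal
    exact congrArg cf0 (funext fun k => congrArg A (by ring))
  rw [lam_eq (fun n => hA (-n)), lam_eq hA, hr, hl]
  ring

theorem leftVal_le_of_lt (hA : ∀ n, 0 < A n) (hB : ∀ n, 0 < B n) {s : ℤ} (h : A s < B s) :
    leftVal B s ≤ leftVal A s := by
  have h1 : (A s : ℝ) + 1 ≤ B s := by exact_mod_cast h
  have h0 : (0 : ℝ) < A s := by exact_mod_cast hA s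
  have h2 := leftVal_mem hA (s - 1)
  have h3 := leftVal_mem hB (s - 1)
  rw [leftVal_eq hA s, leftVal_eq hB s]
  apply one_div_le_one_div_of_le <;> linarith

/-- The alternating lexicographic order on left expansions. -/
theorem leftVal_lex (hA : ∀ n, 0 < A n) (hB : ∀ n, 0 < B n) (n : ℕ) {s : ℤ}
    (heq : ∀ k : ℕ, k < n → A (s - k) = B (s - k)) (h : A (s - n) < B (s - n)) :
    (Even n → leftVal B s ≤ leftVal A s) ∧ (Odd n → leftVal A s ≤ leftVal B s) := by
  induction n generalizing s with
  | zero =>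
    simp only [Nat.cast_zero, sub_zero] at h
    exact ⟨fun _ => leftVal_le_of_lt hA hB h, fun h => by simp at h⟩
  | succ n ih =>
    have h' := ih (s := s - 1) (fun k hk => by
      have := heq (k + 1) (by omega)
      push_cast at this
      rwa [sub_sub, add_comm (1 : ℤ)]) (by
      push_cast at h
      rwa [sub_sub, add_comm (1 : ℤ)])
    have e : A s = B s := by simpa using heq 0 (by omega)
    have h0 : (0 : ℝ) < B s := by exact_mod_cast hB s
    have h2 := leftVal_mem hA (s - 1)
    have h3 := leftVal_mem hB (s - 1)
    rw [leftVal_eq hA s, leftVal_eq hB s, e]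
    constructor
    · intro hn
      apply one_div_le_one_div_of_le (by linarith)
      linarith [h'.2 (by simpa [Nat.even_add_one] using hn)]
    · intro hn
      apply one_div_le_one_div_of_le (by linarith)
      linarith [h'.1 (by simpa [Nat.odd_add_one] using hn)]

end

/-- The digits of `A` at `s, s + 1, ...` begin with `w`. -/
def MatchR (A : ℤ → ℕ) : ℤ → List ℕ → Prop
  | _, [] => True
  | s, n :: w => A s = n ∧ MatchR A (s + 1) w

/-- The digits of `A` at `s, s - 1, ...` begin with `w`. -/
def MatchL (A : ℤ → ℕ) : ℤ → List ℕ → Prop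
  | _, [] => True
  | s, n :: w => A s = n ∧ MatchL A (s - 1) w

/-- The digits of `A` at `s, s + 1, ..., s + n - 1`. -/
def winR (A : ℤ → ℕ) : ℤ → ℕ → List ℕ
  | _, 0 => []
  | s, n + 1 => A s :: winR A (s + 1) n

/-- The digits of `A` at `s, s - 1, ..., s - n + 1`. -/
def winL (A : ℤ → ℕ) : ℤ → ℕ → List ℕ
  | _, 0 => []
  | s, n + 1 => A s :: winL A (s - 1) n

/-- `x = [0; w + y]` for some `y` between `0` and `1`. -/
def Chain : List ℕ → ℝ → Prop
  | [], x => 0 ≤ x ∧ x ≤ 1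
  | n :: w, x => ∃ y, Chain w y ∧ x = 1 / (n + y)

/-- `a / b ≤ x ≤ c / d`, with positive denominators. -/
def Encl (a b c d : ℕ) (x : ℝ) : Prop :=
  0 < b ∧ 0 < d ∧ (a : ℝ) ≤ x * b ∧ x * d ≤ c

/-- `f n`, written so that the kernel evaluates `n` first. -/
def force {α : Type} (n : ℕ) (f : ℕ → α) : α :=
  Nat.rec (f 0) (fun m _ => f (Nat.succ m)) n

/-- Applies `k` to the bounds `a / b ≤ x ≤ c / d` valid for all `x` with `Chain w x`. -/
def withBounds : List ℕ → (ℕ → ℕ → ℕ → ℕ → Bool) → Bool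
  | [], k => k 0 1 1 1
  | n :: w, k => withBounds w fun a b c d =>
      force (n * d + c) fun p => force (n * b + a) fun q => k d p b q

/-- Certifies `n + [0; r...] + [0; l...] ≤ N / D`. -/
def upperCheck (N D n : ℕ) (l r : List ℕ) : Bool :=
  withBounds l fun _ _ c d => withBounds r fun _ _ c₂ d₂ =>
    Nat.ble (D * (n * (d * d₂) + c * d₂ + c₂ * d)) (N * (d * d₂))

/-- Certifies `N / D ≤ n + [0; r...] + [0; l...]`. -/
def lowerCheck (N D n : ℕ) (l r : List ℕ) : Bool :=
  withBounds l fun a b _ _ => withBounds r fun a₂ b₂ _ _ =>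
    Nat.ble (N * (b * b₂)) (D * (n * (b * b₂) + a * b₂ + a₂ * b))

/-- Certifies that some position in a word has `λ ≥ N / D`, where the digits to the left of the
word have value between `a / b` and `c / d`. The bounds for the whole word are passed on. -/
def scan (N D : ℕ) : ℕ → ℕ → ℕ → ℕ → List ℕ → (ℕ → ℕ → ℕ → ℕ → Bool) → Bool
  | _, _, _, _, [], k => k 0 1 1 1
  | a, b, c, d, n :: w, k =>
    force (n * d + c) fun p => force (n * b + a) fun q =>
      scan N D d p b q w fun a₂ b₂ c₂ d₂ =>
        Nat.ble (N * (b * b₂)) (D * (n * (b * b₂) + a * b₂ + a₂ * b)) ||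
          force (n * d₂ + c₂) fun p₂ => force (n * b₂ + a₂) fun q₂ => k d₂ p₂ b₂ q₂

/-- Certifies that every bi-infinite sequence with digits `r` from the origin on, and digits `l` to
the left of it, either has `λ ≥ N / D` near the origin or reaches `goal`. The word is extended by up
to `n` digits from `{1, 2}`, alternately on the right and on the left. -/
def search (N D : ℕ) (goal : List ℕ → List ℕ → Bool) : ℕ → Bool → List ℕ → List ℕ → Bool
  | 0, _, l, r => scan N D 0 1 1 1 (l.reverse ++ r) (fun _ _ _ _ => false) || goal l r
  | n + 1, side, l, r =>
    scan N D 0 1 1 1 (l.reverse ++ r) (fun _ _ _ _ => false) || (goal l r ||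
      (if side then
        search N D goal n false l (r ++ [1]) && search N D goal n false l (r ++ [2])
      else
        search N D goal n true (l ++ [1]) r && search N D goal n true (l ++ [2]) r))

theorem force_eq {α : Type} (n : ℕ) (f : ℕ → α) : force n f = f n := by
  cases n <;> rfl

theorem Encl.of_mem {x : ℝ} (h : 0 ≤ x ∧ x ≤ 1) : Encl 0 1 1 1 x := by
  refine ⟨one_pos, one_pos, ?_, ?_⟩ <;> simp [h.1, h.2]

theorem Encl.step {a b c d n : ℕ} {x : ℝ} (h : Encl a b c d x) (hn : 0 < n) (hx : 0 ≤ x) :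
    Encl d (n * d + c) b (n * b + a) (1 / (n + x)) := by
  obtain ⟨hb, hd, h1, h2⟩ := h
  have hn' : (0 : ℝ) < n := by exact_mod_cast hn
  have hpos : 0 < n + x := by linarith
  refine ⟨by positivity, by positivity, ?_, ?_⟩
  · rw [div_mul_eq_mul_div, le_div_iff₀ hpos]
    push_cast
    linarith
  · rw [div_mul_eq_mul_div, div_le_iff₀ hpos]
    push_cast
    linarith

section
variable {A B : ℤ → ℕ}

theorem MatchR.chain (hA : ∀ n, 0 < A n) {s : ℤ} {w : List ℕ} (h : MatchR A s w) :
    Chain w (rightVal A s) := by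
  induction w generalizing s with
  | nil => exact rightVal_mem hA s
  | cons n w ih => exact ⟨_, ih h.2, by rw [← h.1, rightVal_eq hA s]⟩

theorem MatchL.chain (hA : ∀ n, 0 < A n) {s : ℤ} {w : List ℕ} (h : MatchL A s w) :
    Chain w (leftVal A s) := by
  induction w generalizing s with
  | nil => exact leftVal_mem hA s
  | cons n w ih => exact ⟨_, ih h.2, by rw [← h.1, leftVal_eq hA s]⟩

theorem matchR_winR (A : ℤ → ℕ) (s : ℤ) (n : ℕ) : MatchR A s (winR A s n) := by
  induction n generalizing s with
  | zero => trivial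
  | succ n ih => exact ⟨rfl, ih _⟩

theorem matchL_winL (A : ℤ → ℕ) (s : ℤ) (n : ℕ) : MatchL A s (winL A s n) := by
  induction n generalizing s with
  | zero => trivial
  | succ n ih => exact ⟨rfl, ih _⟩

theorem winR_congr {s t : ℤ} {n : ℕ} (h : ∀ k : ℕ, k < n → A (s + k) = B (t + k)) :
    winR A s n = winR B t n := by
  induction n generalizing s t with
  | zero => rfl
  | succ n ih =>
    have h0 := h 0 (by omega)
    simp only [Nat.cast_zero, add_zero] at h0
    rw [winR, winR, h0, ih fun k hk => ?_]
    have := h (k + 1) (by omega)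
    push_cast at this
    rwa [add_assoc, add_assoc, add_comm (1 : ℤ)]

theorem winL_congr {s t : ℤ} {n : ℕ} (h : ∀ k : ℕ, k < n → A (s - k) = B (t - k)) :
    winL A s n = winL B t n := by
  induction n generalizing s t with
  | zero => rfl
  | succ n ih =>
    have h0 := h 0 (by omega)
    simp only [Nat.cast_zero, sub_zero] at h0
    rw [winL, winL, h0, ih fun k hk => ?_]
    have := h (k + 1) (by omega)
    push_cast at this
    rwa [sub_sub, sub_sub, add_comm (1 : ℤ)]

theorem matchR_shift (o s : ℤ) (w : List ℕ) :
    MatchR (fun n => A (o + n)) s w ↔ MatchR A (o + s) w := by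
  induction w generalizing s with
  | nil => exact Iff.rfl
  | cons n w ih => simp only [MatchR, ih, add_assoc]

theorem matchL_shift (o s : ℤ) (w : List ℕ) :
    MatchL (fun n => A (o + n)) s w ↔ MatchL A (o + s) w := by
  induction w generalizing s with
  | nil => exact Iff.rfl
  | cons n w ih => simp only [MatchL, ih, add_sub_assoc]

theorem MatchR.neg {s : ℤ} {w : List ℕ} (h : MatchR A s w) :
    MatchL (fun n => A (-n)) (-s) w := by
  induction w generalizing s with
  | nil => trivial
  | cons n w ih =>
    refine ⟨by simpa using h.1, ?_⟩
    have := ih h.2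
    rwa [neg_add] at this

theorem MatchL.neg {s : ℤ} {w : List ℕ} (h : MatchL A s w) :
    MatchR (fun n => A (-n)) (-s) w := by
  induction w generalizing s with
  | nil => trivial
  | cons n w ih =>
    refine ⟨by simpa using h.1, ?_⟩
    have := ih h.2
    rwa [neg_sub, sub_eq_add_neg, add_comm] at this

theorem MatchR.append_singleton {s : ℤ} {w : List ℕ} (h : MatchR A s w) {n : ℕ}
    (hn : A (s + w.length) = n) : MatchR A s (w ++ [n]) := by
  induction w generalizing s with
  | nil => exact ⟨by simpa using hn, trivial⟩
  | cons m w ih =>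
    refine ⟨h.1, ih h.2 ?_⟩
    rw [← hn]
    congr 1
    push_cast [List.length_cons]
    ring

theorem MatchL.append_singleton {s : ℤ} {w : List ℕ} (h : MatchL A s w) {n : ℕ}
    (hn : A (s - w.length) = n) : MatchL A s (w ++ [n]) := by
  induction w generalizing s with
  | nil => exact ⟨by simpa using hn, trivial⟩
  | cons m w ih =>
    refine ⟨h.1, ih h.2 ?_⟩
    rw [← hn]
    congr 1
    push_cast [List.length_cons]
    ring

theorem MatchL.reverse_append {s : ℤ} {l r : List ℕ} (hl : MatchL A (s - 1) l)
    (hr : MatchR A s r) : MatchR A (s - l.length) (l.reverse ++ r) := by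
  induction l generalizing s r with
  | nil => simpa using hr
  | cons n l ih =>
    have h := ih (s := s - 1) (r := n :: r) hl.2 ⟨hl.1, by simpa using hr⟩
    rw [List.reverse_cons, List.append_assoc, List.singleton_append]
    convert h using 1
    push_cast [List.length_cons]
    ring

theorem MatchR.of_isPrefixOf {s : ℤ} {p w : List ℕ} (hp : p.isPrefixOf w = true)
    (h : MatchR A s w) : MatchR A s p := by
  obtain ⟨t, rfl⟩ := List.isPrefixOf_iff_prefix.1 hp
  induction p generalizing s with
  | nil => trivial
  | cons n p ih => exact ⟨h.1, ih (by simp) h.2⟩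

theorem MatchL.of_isPrefixOf {s : ℤ} {p w : List ℕ} (hp : p.isPrefixOf w = true)
    (h : MatchL A s w) : MatchL A s p := by
  obtain ⟨t, rfl⟩ := List.isPrefixOf_iff_prefix.1 hp
  induction p generalizing s with
  | nil => trivial
  | cons n p ih => exact ⟨h.1, ih (by simp) h.2⟩

theorem Chain.nonneg {w : List ℕ} {x : ℝ} (h : Chain w x) : 0 ≤ x := by
  induction w generalizing x with
  | nil => exact h.1
  | cons n w ih =>
    obtain ⟨y, hy, rfl⟩ := h
    have := ih hy
    positivity

theorem withBounds_sound {w : List ℕ} (hw : ∀ n ∈ w, 0 < n) {x : ℝ} (hx : Chain w x)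
    {k : ℕ → ℕ → ℕ → ℕ → Bool} (h : withBounds w k = true) :
    ∃ a b c d, Encl a b c d x ∧ k a b c d = true := by
  induction w generalizing x k with
  | nil => exact ⟨_, _, _, _, Encl.of_mem hx, h⟩
  | cons n w ih =>
    obtain ⟨y, hy, rfl⟩ := hx
    obtain ⟨a, b, c, d, he, hk⟩ := ih (fun n hn => hw n (List.mem_cons_of_mem _ hn)) hy h
    simp only [force_eq] at hk
    exact ⟨_, _, _, _, he.step (hw n List.mem_cons_self) hy.nonneg, hk⟩

theorem le_div_of_encl {N D n a b c d a' b' c' d' : ℕ} {x y : ℝ} (hD : 0 < D)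
    (hx : Encl a b c d x) (hy : Encl a' b' c' d' y)
    (h : Nat.ble (D * (n * (d * d') + c * d' + c' * d)) (N * (d * d')) = true) :
    n + y + x ≤ (N : ℝ) / D := by
  obtain ⟨-, hd, -, h1⟩ := hx
  obtain ⟨-, hd', -, h2⟩ := hy
  have h3 := Nat.le_of_ble_eq_true h
  have h4 : (D * (n * (d * d') + c * d' + c' * d) : ℝ) ≤ N * (d * d') := by exact_mod_cast h3
  have hd0 : (0 : ℝ) < d := by exact_mod_cast hd
  have hd0' : (0 : ℝ) < d' := by exact_mod_cast hd'
  have hD0 : (0 : ℝ) < D := by exact_mod_cast hD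
  rw [le_div_iff₀ hD0]
  have h5 : (n + y + x) * (d * d') ≤ n * (d * d') + c * d' + c' * d := by
    nlinarith [mul_le_mul_of_nonneg_right h1 hd0'.le, mul_le_mul_of_nonneg_right h2 hd0.le]
  have h6 : (n + y + x) * D * (d * d') ≤ N * (d * d') := by
    nlinarith [mul_le_mul_of_nonneg_left h5 hD0.le]
  exact le_of_mul_le_mul_right h6 (by positivity)

theorem div_le_of_encl {N D n a b c d a' b' c' d' : ℕ} {x y : ℝ} (hD : 0 < D)
    (hx : Encl a b c d x) (hy : Encl a' b' c' d' y)
    (h : Nat.ble (N * (b * b')) (D * (n * (b * b') + a * b' + a' * b)) = true) :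
    (N : ℝ) / D ≤ n + y + x := by
  obtain ⟨hb, -, h1, -⟩ := hx
  obtain ⟨hb', -, h2, -⟩ := hy
  have h3 := Nat.le_of_ble_eq_true h
  have h4 : (N * (b * b') : ℝ) ≤ D * (n * (b * b') + a * b' + a' * b) := by exact_mod_cast h3
  have hb0 : (0 : ℝ) < b := by exact_mod_cast hb
  have hb0' : (0 : ℝ) < b' := by exact_mod_cast hb'
  have hD0 : (0 : ℝ) < D := by exact_mod_cast hD
  rw [div_le_iff₀ hD0]
  have h5 : n * (b * b') + a * b' + a' * b ≤ (n + y + x) * (b * b') := by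
    nlinarith [mul_le_mul_of_nonneg_right h1 hb0'.le, mul_le_mul_of_nonneg_right h2 hb0.le]
  have h6 : N * (b * b') ≤ (n + y + x) * D * (b * b') := by
    nlinarith [mul_le_mul_of_nonneg_left h5 hD0.le]
  exact le_of_mul_le_mul_right h6 (by positivity)

theorem MatchR.pos (hA : ∀ n, 0 < A n) {s : ℤ} {w : List ℕ} (h : MatchR A s w) :
    ∀ n ∈ w, 0 < n := by
  induction w generalizing s with
  | nil => simp
  | cons m w ih => exact List.forall_mem_cons.2 ⟨h.1 ▸ hA s, ih h.2⟩

theorem MatchL.pos (hA : ∀ n, 0 < A n) {s : ℤ} {w : List ℕ} (h : MatchL A s w) :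
    ∀ n ∈ w, 0 < n := by
  induction w generalizing s with
  | nil => simp
  | cons m w ih => exact List.forall_mem_cons.2 ⟨h.1 ▸ hA s, ih h.2⟩

theorem lam_le_of_upperCheck {N D : ℕ} (hD : 0 < D) (hA : ∀ n, 0 < A n) {s : ℤ}
    {l r : List ℕ} (hl : MatchL A (s - 1) l) (hr : MatchR A (s + 1) r)
    (h : upperCheck N D (A s) l r = true) : lam A s ≤ (N : ℝ) / D := by
  obtain ⟨a, b, c, d, he, h⟩ := withBounds_sound (hl.pos hA) (hl.chain hA) h
  obtain ⟨a', b', c', d', he', h⟩ := withBounds_sound (hr.pos hA) (hr.chain hA) h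
  rw [lam_eq hA]
  exact le_div_of_encl hD he he' h

theorem le_lam_of_lowerCheck {N D : ℕ} (hD : 0 < D) (hA : ∀ n, 0 < A n) {s : ℤ}
    {l r : List ℕ} (hl : MatchL A (s - 1) l) (hr : MatchR A (s + 1) r)
    (h : lowerCheck N D (A s) l r = true) : (N : ℝ) / D ≤ lam A s := by
  obtain ⟨a, b, c, d, he, h⟩ := withBounds_sound (hl.pos hA) (hl.chain hA) h
  obtain ⟨a', b', c', d', he', h⟩ := withBounds_sound (hr.pos hA) (hr.chain hA) h
  rw [lam_eq hA]
  exact div_le_of_encl hD he he' h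

theorem scan_sound {N D : ℕ} (hD : 0 < D) (hA : ∀ n, 0 < A n) {P : Prop} {w : List ℕ}
    {s : ℤ} {a b c d : ℕ} {k : ℕ → ℕ → ℕ → ℕ → Bool}
    (hlam : ∀ j, s ≤ j → j < s + w.length → lam A j < (N : ℝ) / D)
    (hw : MatchR A s w) (he : Encl a b c d (leftVal A (s - 1)))
    (hk : ∀ a b c d, Encl a b c d (rightVal A s) → k a b c d = true → P)
    (h : scan N D a b c d w k = true) : P := by
  induction w generalizing s a b c d k with
  | nil => exact hk _ _ _ _ (Encl.of_mem (rightVal_mem hA s)) h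
  | cons n w ih =>
    simp only [scan, force_eq] at h
    have hn : 0 < n := hw.1 ▸ hA s
    refine ih (s := s + 1) (fun j h1 h2 => hlam j (by omega) ?_) hw.2 ?_ ?_ h
    · push_cast [List.length_cons]
      omega
    · have := he.step hn (leftVal_mem hA _).1
      rwa [add_sub_cancel_right, leftVal_eq hA s, hw.1]
    · intro a' b' c' d' he' h'
      rcases Bool.or_eq_true _ _ ▸ h' with h' | h'
      · have h1 := div_le_of_encl hD he he' h'
        have h2 := hlam s le_rfl (by push_cast [List.length_cons]; omega)
        rw [lam_eq hA, hw.1] at h2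
        linarith
      · refine hk _ _ _ _ ?_ h'
        have := he'.step hn (rightVal_mem hA _).1
        rwa [rightVal_eq hA s, hw.1]

theorem search_sound {N D : ℕ} (hD : 0 < D) (hA : ∀ n, 0 < A n) {P : Prop}
    {goal : List ℕ → List ℕ → Bool}
    (hgoal : ∀ l r, goal l r = true → MatchL A (-1) l → MatchR A 0 r → P)
    {R n : ℕ} (hR : ∀ k : ℤ, |k| ≤ R → (A k = 1 ∨ A k = 2) ∧ lam A k < (N : ℝ) / D)
    {side : Bool} {l r : List ℕ} (hlR : l.length + n ≤ R) (hrR : r.length + n ≤ R)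
    (hl : MatchL A (-1) l) (hr : MatchR A 0 r) (h : search N D goal n side l r = true) : P := by
  have hscan : ∀ {l r : List ℕ}, l.length ≤ R → r.length ≤ R → MatchL A (-1) l →
      MatchR A 0 r →
      scan N D 0 1 1 1 (l.reverse ++ r) (fun _ _ _ _ => false) = true → P := by
    intro l r hlR hrR hl hr h
    refine scan_sound hD hA (fun j h1 h2 => (hR j ?_).2) (MatchL.reverse_append hl hr)
      (Encl.of_mem (leftVal_mem hA _)) (by simp) h
    push_cast [List.length_append, List.length_reverse] at h2
    rw [abs_le]
    omega
  induction n generalizing side l r with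
  | zero =>
    rcases Bool.or_eq_true _ _ ▸ h with h | h
    · exact hscan (by omega) (by omega) hl hr h
    · exact hgoal _ _ h hl hr
  | succ n ih =>
    simp only [search, Bool.or_eq_true] at h
    rcases h with h | h | h
    · exact hscan (by omega) (by omega) hl hr h
    · exact hgoal _ _ h hl hr
    · have hlen : ∀ (w : List ℕ) (m : ℕ), (w ++ [m]).length = w.length + 1 := by simp
      cases side with
      | true =>
        simp only [if_true, Bool.and_eq_true] at h
        rcases (hR (0 + r.length) (by rw [abs_le]; omega)).1 with h1 | h1
        · exact ih (by omega) (by rw [hlen]; omega) hl (hr.append_singleton h1) h.1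
        · exact ih (by omega) (by rw [hlen]; omega) hl (hr.append_singleton h1) h.2
      | false =>
        simp only [Bool.false_eq_true, if_false, Bool.and_eq_true] at h
        rcases (hR (-1 - l.length) (by rw [abs_le]; omega)).1 with h1 | h1
        · exact ih (by rw [hlen]; omega) (by omega) (hl.append_singleton h1) hr h.1
        · exact ih (by rw [hlen]; omega) (by omega) (hl.append_singleton h1) hr h.2

theorem lam_le_of_window {N D n : ℕ} (hD : 0 < D) (hA : ∀ n, 0 < A n) {s t : ℤ}
    (hAB : ∀ x : ℤ, |x| ≤ n → A (s + x) = B (t + x))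
    (h : upperCheck N D (B t) (winL B (t - 1) n) (winR B (t + 1) n) = true) :
    lam A s ≤ (N : ℝ) / D := by
  have h0 : A s = B t := by simpa using hAB 0 (by simp)
  have hl : winL A (s - 1) n = winL B (t - 1) n := winL_congr fun k hk => by
    have := hAB (-1 - k) (by rw [abs_le]; omega)
    rwa [← add_sub_assoc, ← add_sub_assoc] at this
  have hr : winR A (s + 1) n = winR B (t + 1) n := winR_congr fun k hk => by
    have := hAB (1 + k) (by rw [abs_le]; omega)
    rwa [← add_assoc, ← add_assoc] at this
  rw [← h0, ← hl, ← hr] at h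
  exact lam_le_of_upperCheck hD hA (matchL_winL _ _ _) (matchR_winR _ _ _) h

end

/-- The bi-infinite sequence with right half `a` (from the origin on) and left half `g`. -/
def glue (a g : ℕ → ℕ) : ℤ → ℕ := fun n => if 0 ≤ n then a n.toNat else g (-1 - n).toNat

theorem lam_glue (a g : ℕ → ℕ) : lam (glue a g) 0 = cfVal a + cf0 g := by
  unfold lam
  congr 2
  · funext n
    simp [glue]
  · funext n
    simp only [glue]
    rw [if_neg (by omega)]
    congr 1
    omega

theorem glue_pos {a g : ℕ → ℕ} (ha : ∀ n, 0 < a n) (hg : ∀ n, 0 < g n) (n : ℤ) :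
    0 < glue a g n := by
  unfold glue
  split
  exacts [ha _, hg _]

theorem getD_one_pos {w : List ℕ} (hw : ∀ n ∈ w, 0 < n) (k : ℕ) : 0 < w.getD k 1 := by
  rw [List.getD_eq_getElem?_getD]
  rcases h : w[k]? with _ | n
  · simp
  · exact hw n (List.mem_of_getElem? h)

theorem perSeq_pos {w : List ℕ} (hw : ∀ n ∈ w, 0 < n) (n : ℕ) : 0 < perSeq w n :=
  getD_one_pos hw _

theorem prePer_pos {p w : List ℕ} (hp : ∀ n ∈ p, 0 < n) (hw : ∀ n ∈ w, 0 < n) (n : ℕ) :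
    0 < prePer p w n := by
  unfold prePer catSeq
  split
  exacts [getD_one_pos hp _, perSeq_pos hw _]

/-- The periodic sequence with Markov value `c_∞`. -/
def perA : ℤ → ℕ := perZ [2,2,2,2,1,1,2,2,1]

/-- The sequence with Markov value `f`. -/
def leastA : ℤ → ℕ :=
  glue (perSeq [2,2,2,2,1,1,2,2,1]) (prePer [1,2,2,1,1,2,2,2,2,1,2,2,1,1,2,2,1,1] [2,2,2,1,1,1])

/-- The sequence with `λ_0 = C_∞`. -/
def upperA : ℤ → ℕ :=
  glue (prePer [2,1,2,2,1,1,2,2,2,2,1,2,2,1,1,2,2,2,2,1,2,2,1,1,2,2,1,2,2,2,2,1,1]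
    [2,2,2,1,1,1]) (prePer [2,2,2,1,1,2,2,1,2,2,2,2,1] [1,1,1,2,2,2])

theorem perA_pos (n : ℤ) : 0 < perA n := getD_one_pos (by decide) _

theorem leastA_pos (n : ℤ) : 0 < leastA n :=
  glue_pos (perSeq_pos (by decide)) (prePer_pos (by decide) (by decide)) n

theorem upperA_pos (n : ℤ) : 0 < upperA n :=
  glue_pos (prePer_pos (by decide) (by decide)) (prePer_pos (by decide) (by decide)) n

theorem perA_congr {x y : ℤ} (h : x % 9 = y % 9) : perA x = perA y := by
  simp only [perA, perZ, List.length_cons, List.length_nil]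
  norm_num [h]

theorem perA_eq_emod (x : ℤ) : perA x = perA (x % 9) :=
  perA_congr (Int.emod_emod_of_dvd x dvd_rfl).symm

theorem leastA_eq_perA {x : ℤ} (hx : -17 < x) : leastA x = perA x := by
  rcases lt_or_ge x 0 with h | h
  · interval_cases x <;> rfl
  · obtain ⟨n, rfl⟩ := Int.eq_ofNat_of_zero_le h
    simp only [leastA, glue, perA, perZ, perSeq, if_pos h]
    rfl

theorem leastA_eq_of_le {x : ℤ} (hx : x ≤ -17) :
    leastA x = if (-13 - x) % 6 < 3 then 2 else 1 := by
  have h0 : ¬ 0 ≤ x := by omega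
  obtain ⟨n, rfl⟩ : ∃ n : ℕ, x = -17 - n := ⟨(-17 - x).toNat, by omega⟩
  have e : (-1 - (-17 - (n : ℤ))).toNat = n + 16 := by omega
  simp only [leastA, glue, if_neg h0, e, prePer, catSeq, List.length_cons, List.length_nil]
  by_cases hn : n < 2
  · interval_cases n <;> rfl
  · obtain ⟨m, rfl⟩ : ∃ m, n = m + 2 := ⟨n - 2, by omega⟩
    have e2 : (-13 - (-17 - ((m + 2 : ℕ) : ℤ))) % 6 = ((m % 6 : ℕ) : ℤ) := by omega
    rw [if_neg (by omega), e2]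
    have e3 : m + 2 + 16 - (0 + 1 + 1 + 1 + 1 + 1 + 1 + 1 + 1 + 1 + 1 + 1 + 1 + 1 + 1 + 1 + 1 + 1 + 1)
      = m := by omega
    rw [e3]
    have : m % 6 < 6 := Nat.mod_lt _ (by norm_num)
    change [2,2,2,1,1,1].getD (m % 6) 1 = _
    generalize m % 6 = r at *
    interval_cases r <;> rfl

theorem lam_perA_zero : lam perA 0 = cInf := by
  unfold lam cInf
  congr 2
  · funext n
    simp only [perA, perZ, perSeq, zero_add]
    rfl
  · funext n
    rw [perA_eq_emod]
    have h1 : (0 - 1 - (n : ℤ)) % 9 = 8 - ((n % 9 : ℕ) : ℤ) := by omega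
    have : n % 9 < 9 := Nat.mod_lt _ (by norm_num)
    rw [h1]
    change _ = [1,2,2,1,1,2,2,2,2].getD (n % 9) 1
    generalize n % 9 = r at *
    interval_cases r <;> rfl

theorem lam_leastA_zero : lam leastA 0 = fV := lam_glue _ _

theorem lam_upperA_zero : lam upperA 0 = CInf := lam_glue _ _

theorem cInf_le : cInf ≤ (3118120178150 : ℕ) / (1000000000000 : ℕ) := by
  rw [← lam_perA_zero]
  exact lam_le_of_window (n := 25) (by norm_num) perA_pos (fun x _ => rfl) (by decide +kernel)

theorem le_cInf : (3118120178140 : ℕ) / (1000000000000 : ℕ) ≤ cInf := by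
  rw [← lam_perA_zero]
  exact le_lam_of_lowerCheck (by norm_num) perA_pos (matchL_winL _ _ 25) (matchR_winR _ _ 25)
    (by decide +kernel)

theorem fV_le : fV ≤ (3118120178160 : ℕ) / (1000000000000 : ℕ) := by
  rw [← lam_leastA_zero]
  exact lam_le_of_window (n := 25) (by norm_num) leastA_pos (fun x _ => rfl) (by decide +kernel)

theorem le_fV : (3118120178155 : ℕ) / (1000000000000 : ℕ) ≤ fV := by
  rw [← lam_leastA_zero]
  exact le_lam_of_lowerCheck (by norm_num) leastA_pos (matchL_winL _ _ 25) (matchR_winR _ _ 25)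
    (by decide +kernel)

theorem le_CInf : (3118120178200 : ℕ) / (1000000000000 : ℕ) ≤ CInf := by
  rw [← lam_upperA_zero]
  exact le_lam_of_lowerCheck (by norm_num) upperA_pos (matchL_winL _ _ 25) (matchR_winR _ _ 25)
    (by decide +kernel)

theorem cInf_lt_fV : cInf < fV :=
  cInf_le.trans_lt (lt_of_lt_of_le (by norm_num) le_fV)

theorem fV_lt_CInf : fV < CInf :=
  fV_le.trans_lt (lt_of_lt_of_le (by norm_num) le_CInf)

/-- Away from breaks of the period, the values `λ_j` are close to `c_∞` or smaller. -/
theorem lam_le_of_eq_perA {A : ℤ → ℕ} (hA : ∀ n, 0 < A n) {s o : ℤ}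
    (h : ∀ x : ℤ, |x| ≤ 25 → A (s + x) = perA (s - o + x)) :
    lam A s ≤ (3118120178150 : ℕ) / (1000000000000 : ℕ) := by
  have key : ∀ i < 9, upperCheck 3118120178150 1000000000000 (perA (i : ℕ))
      (winL perA (i - 1) 25) (winR perA (i + 1) 25) = true := by
    decide +kernel
  obtain ⟨i, hi, hi'⟩ : ∃ i : ℕ, i < 9 ∧ (i : ℤ) = (s - o) % 9 :=
    ⟨((s - o) % 9).toNat, by omega, by omega⟩
  refine lam_le_of_window (by norm_num) hA (fun x hx => ?_) (key i hi)
  rw [h x (by exact_mod_cast hx)]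
  exact perA_congr (by omega)

theorem lam_leastA_le {s : ℤ} (hs : s ≠ 0) :
    lam leastA s ≤ (3118120178150 : ℕ) / (1000000000000 : ℕ) := by
  have key : ∀ i < 70, i ≠ 60 → upperCheck 3118120178150 1000000000000
      (leastA ((i : ℕ) - 60)) (winL leastA (i - 60 - 1) 25) (winR leastA (i - 60 + 1) 25)
        = true := by
    decide +kernel
  rcases lt_or_ge s 9 with h9 | h9
  · rcases lt_or_ge s (-60) with h60 | h60
    · obtain ⟨i, hi, hi'⟩ : ∃ i : ℕ, i < 6 ∧ (i : ℤ) = s % 6 :=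
        ⟨(s % 6).toNat, by omega, by omega⟩
      refine lam_le_of_window (by norm_num) leastA_pos (fun x hx => ?_)
        (key i (by omega) (by omega))
      rw [abs_le] at hx
      push_cast at hx
      rw [leastA_eq_of_le (by omega), leastA_eq_of_le (by omega)]
      congr 2
      omega
    · obtain ⟨i, rfl⟩ : ∃ i : ℕ, s = i - 60 := ⟨(s + 60).toNat, by omega⟩
      exact lam_le_of_window (by norm_num) leastA_pos (fun x _ => rfl)
        (key i (by omega) (by omega))
  · refine lam_le_of_eq_perA leastA_pos (o := 0) fun x hx => ?_
    rw [abs_le] at hx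
    rw [leastA_eq_perA (by omega), sub_zero]

theorem lam_leastA_le_fV (s : ℤ) : lam leastA s ≤ fV := by
  rcases eq_or_ne s 0 with rfl | hs
  · exact lam_leastA_zero.le
  · exact (lam_leastA_le hs).trans (le_trans (by norm_num) le_fV)

theorem fV_mem_markovSpectrum : fV ∈ MarkovSpectrum := by
  have h : IsGreatest (Set.range (lam leastA)) fV :=
    ⟨⟨0, lam_leastA_zero⟩, by rintro _ ⟨s, rfl⟩; exact lam_leastA_le_fV s⟩
  exact ⟨leastA, leastA_pos, ⟨fV, h.2⟩, h.csSup_eq.symm⟩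

/-- The digit `A s` is `1` or `2` and `λ_s(A)` is below a bound slightly larger than `f`. -/
def Admissible (A : ℤ → ℕ) (s : ℤ) : Prop :=
  (A s = 1 ∨ A s = 2) ∧ lam A s < (3118120178200 : ℕ) / (1000000000000 : ℕ)

/-- Around `s`, the sequence agrees with the periodic sequence around the origin. -/
def PeriodicAt (A : ℤ → ℕ) (s : ℤ) : Prop :=
  MatchL A (s - 1) [1,2,2,1,1,2,2,2] ∧ MatchR A s [2,2,2,2,1,1,2]

section
variable {A : ℤ → ℕ}

theorem admissible_shift (o s : ℤ) :
    Admissible (fun n => A (o + n)) s ↔ Admissible A (o + s) := by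
  simp only [Admissible, lam_shift]

theorem periodicAt_shift (o s : ℤ) :
    PeriodicAt (fun n => A (o + n)) s ↔ PeriodicAt A (o + s) := by
  simp only [PeriodicAt, matchL_shift, matchR_shift, add_sub_assoc]

theorem admissible_neg (hA : ∀ n, 0 < A n) {s : ℤ} (h : Admissible A (-s)) :
    Admissible (fun n => A (-n)) s := by
  simpa only [Admissible, lam_neg hA] using h

theorem le_three_of_lam_lt (hA : ∀ n, 0 < A n) {s : ℤ}
    (h : lam A s < (3118120178200 : ℕ) / (1000000000000 : ℕ)) : A s ≤ 3 := by
  have h1 := rightVal_mem hA (s + 1)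
  have h2 := leftVal_mem hA (s - 1)
  rw [lam_eq hA] at h
  by_contra! h3
  have h4 : (4 : ℝ) ≤ A s := by exact_mod_cast h3
  norm_num at h
  linarith

theorem admissible_of_lam_lt (hA : ∀ n, 0 < A n) {s : ℤ}
    (h : ∀ k, s - 1 ≤ k → lam A k < (3118120178200 : ℕ) / (1000000000000 : ℕ)) :
    Admissible A s := by
  have hs := h s (by omega)
  refine ⟨?_, hs⟩
  have h0 := le_three_of_lam_lt hA hs
  have hp := hA s
  by_contra! hne
  have h3 : A s = 3 := by omega
  have hl : (A (s - 1) : ℝ) ≤ 3 := by exact_mod_cast le_three_of_lam_lt hA (h (s - 1) le_rfl)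
  have hr : (A (s + 1) : ℝ) ≤ 3 := by exact_mod_cast le_three_of_lam_lt hA (h (s + 1) (by omega))
  have hl0 : (0 : ℝ) < A (s - 1) := by exact_mod_cast hA _
  have hr0 : (0 : ℝ) < A (s + 1) := by exact_mod_cast hA _
  have h1 := rightVal_mem hA (s + 1 + 1)
  have h2 := leftVal_mem hA (s - 1 - 1)
  have h5 : 1 / (4 : ℝ) ≤ rightVal A (s + 1) := by
    rw [rightVal_eq hA]
    apply one_div_le_one_div_of_le <;> linarith
  have h6 : 1 / (4 : ℝ) ≤ leftVal A (s - 1) := by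
    rw [leftVal_eq hA]
    apply one_div_le_one_div_of_le <;> linarith
  rw [lam_eq hA, h3] at hs
  norm_num at hs
  linarith

/-- Near every large value `λ_0` the sequence, or its reflection, looks like the periodic one. -/
theorem periodicAt_of_lt_lam (hA : ∀ n, 0 < A n) (hR : ∀ k : ℤ, |k| ≤ 50 → Admissible A k)
    (h : (3118120178140 : ℕ) / (1000000000000 : ℕ) < lam A 0) :
    PeriodicAt A 0 ∨ PeriodicAt (fun n => A (-n)) 0 := by
  let goal : List ℕ → List ℕ → Bool := fun l r =>
    (!r.isEmpty && upperCheck 3118120178140 1000000000000 r.headI l r.tail) ||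
      ((List.isPrefixOf [1,2,2,1,1,2,2,2] l && List.isPrefixOf [2,2,2,2,1,1,2] r) ||
        (List.isPrefixOf [2,2,2,1,1,2] l && List.isPrefixOf [2,1,2,2,1,1,2,2,2] r))
  have hs1 : search 3118120178200 1000000000000 goal 30 true [] [1] = true := by decide +kernel
  have hs2 : search 3118120178200 1000000000000 goal 30 true [] [2] = true := by decide +kernel
  have hgoal : ∀ l r, goal l r = true → MatchL A (-1) l → MatchR A 0 r →
      PeriodicAt A 0 ∨ PeriodicAt (fun n => A (-n)) 0 := by
    intro l r hg hlm hrm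
    simp only [goal, Bool.or_eq_true, Bool.and_eq_true] at hg
    rcases hg with ⟨hr, hg⟩ | ⟨h1, h2⟩ | ⟨h1, h2⟩
    · obtain ⟨n, r, rfl⟩ := List.exists_cons_of_ne_nil (l := r) (by simpa using hr)
      refine absurd h (not_lt.2 (lam_le_of_upperCheck (by norm_num) hA hlm hrm.2 ?_))
      rw [hrm.1]
      exact hg
    · exact Or.inl ⟨hlm.of_isPrefixOf h1, hrm.of_isPrefixOf h2⟩
    · have h3 := (hlm.of_isPrefixOf h1).neg
      have h4 := (hrm.of_isPrefixOf h2).neg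
      exact Or.inr ⟨h4.2, by simpa using h4.1, h3⟩
  rcases (hR 0 (by simp)).1 with h0 | h0
  · exact search_sound (R := 50) (by norm_num) hA hgoal (fun k hk => hR k (by simpa using hk))
      (by simp) (by simp) (l := []) (r := [1]) trivial ⟨h0, trivial⟩ hs1
  · exact search_sound (R := 50) (by norm_num) hA hgoal (fun k hk => hR k (by simpa using hk))
      (by simp) (by simp) (l := []) (r := [2]) trivial ⟨h0, trivial⟩ hs2

theorem PeriodicAt.add_nine (hA : ∀ n, 0 < A n) {s : ℤ}
    (hR : ∀ k : ℤ, |k - s| ≤ 50 → Admissible A k) (h : PeriodicAt A s) :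
    PeriodicAt A (s + 9) := by
  have hs : search 3118120178200 1000000000000
      (fun _ r => List.isPrefixOf [2,2,2,2,1,1,2,2,1,2,2,2,2,1,1,2] r) 30 true
      [1,2,2,1,1,2,2,2] [2,2,2,2,1,1,2] = true := by decide +kernel
  have h' : PeriodicAt (fun n => A (s + n)) 0 := by rwa [periodicAt_shift, add_zero]
  rw [← periodicAt_shift]
  refine search_sound (A := fun n => A (s + n)) (R := 50) (by norm_num) (fun n => hA _) ?_
    (fun k hk => (admissible_shift s k).2 (hR _ (by simpa using hk))) (by simp) (by simp)
    h'.1 h'.2 hs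
  intro l r hg _ hr
  have := hr.of_isPrefixOf hg
  simp only [MatchR, zero_add] at this
  norm_num at this
  simp [PeriodicAt, MatchR, MatchL, this]

theorem PeriodicAt.add_mul (hA : ∀ n, 0 < A n) {s a b : ℤ}
    (hR : ∀ k : ℤ, a ≤ k → k ≤ b → Admissible A k) (h : PeriodicAt A s) (ha : a + 50 ≤ s)
    (n : ℕ) (hb : s + 9 * n + 50 ≤ b) : PeriodicAt A (s + 9 * n) := by
  induction n with
  | zero => simpa using h
  | succ n ih =>
    push_cast at hb ⊢
    have := (ih (by omega)).add_nine hA fun k hk => hR k (by rw [abs_le] at hk; omega)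
      (by rw [abs_le] at hk; omega)
    rwa [mul_add, mul_one, ← add_assoc]

theorem PeriodicAt.eq_perA {s : ℤ} (h : PeriodicAt A s) {x : ℤ} (h1 : -8 ≤ x) (h2 : x ≤ 6) :
    A (s + x) = perA x := by
  rw [← add_zero s, ← periodicAt_shift] at h
  simp only [PeriodicAt, MatchR, MatchL] at h
  norm_num at h
  interval_cases x <;> simp [h] <;> rfl

theorem eq_perA_of_periodicAt {s : ℤ} {m : ℕ}
    (h : ∀ n : ℕ, n ≤ m → PeriodicAt A (s + 9 * n)) {x : ℤ} (h1 : s - 8 ≤ x)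
    (h2 : x ≤ s + 9 * m) : A x = perA (x - s) := by
  obtain ⟨n, hn⟩ : ∃ n : ℕ, (n : ℤ) = (x - s + 8) / 9 := ⟨((x - s + 8) / 9).toNat, by omega⟩
  have := (h n (by omega)).eq_perA (x := x - s - 9 * n) (by omega) (by omega)
  rw [show s + 9 * n + (x - s - 9 * n) = x by ring] at this
  rw [this]
  exact perA_congr (by omega)

/-- To the right of a periodic pattern, `λ` stays below `c_∞` up to a small error. -/
theorem lam_le_of_periodicAt (hA : ∀ n, 0 < A n) {s a b j : ℤ}
    (hR : ∀ k : ℤ, a ≤ k → k ≤ b → Admissible A k) (h : PeriodicAt A s) (ha : a + 50 ≤ s)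
    (hj : s + 25 ≤ j) (hb : j + 100 ≤ b) :
    lam A j ≤ (3118120178150 : ℕ) / (1000000000000 : ℕ) := by
  obtain ⟨m, hm⟩ : ∃ m : ℕ, (m : ℤ) = (j + 40 - s) / 9 := ⟨((j + 40 - s) / 9).toNat, by omega⟩
  refine lam_le_of_eq_perA hA (o := s) fun x hx => ?_
  rw [abs_le] at hx
  rw [eq_perA_of_periodicAt (s := s) (m := m)
    (fun n hn => h.add_mul hA hR ha n (by omega)) (by omega) (by omega)]
  congr 1
  ring

theorem fV_notMem_lagrangeSpectrum : fV ∉ LagrangeSpectrum := by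
  rintro ⟨A, hA, hbdd, hf⟩
  have hge : IsBoundedUnder (· ≥ ·) atTop (lam A) := by
    refine ⟨0, eventually_map.2 (Eventually.of_forall fun j => ?_)⟩
    rw [lam_eq hA]
    have h1 := rightVal_mem hA (j + 1)
    have h2 := leftVal_mem hA (j - 1)
    have : (0 : ℝ) ≤ A j := by positivity
    change 0 ≤ _
    linarith
  have hlt : limsup (lam A) atTop < (3118120178200 : ℕ) / (1000000000000 : ℕ) := by
    change lagrangeVal A < _
    rw [← hf]
    exact fV_le.trans_lt (by norm_num)
  have hgt : (3118120178150 : ℕ) / (1000000000000 : ℕ) < limsup (lam A) atTop := by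
    change _ < lagrangeVal A
    rw [← hf]
    exact lt_of_lt_of_le (by norm_num) le_fV
  obtain ⟨N, hN⟩ := eventually_atTop.1 (eventually_lt_of_limsup_lt hlt hbdd)
  have hfreq := frequently_atTop.1 (frequently_lt_of_lt_limsup hge.isCoboundedUnder_le hgt)
  have hadm : ∀ k, N + 1 ≤ k → Admissible A k := fun k hk =>
    admissible_of_lam_lt hA fun j hj => hN j (by omega)
  have key : ∀ i, N + 60 ≤ i → (3118120178150 : ℕ) / (1000000000000 : ℕ) < lam A i →
      PeriodicAt A i ∨ PeriodicAt (fun n => A (-n)) (-i) := by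
    intro i hi hlam
    have := periodicAt_of_lt_lam (A := fun n => A (i + n)) (fun n => hA _)
      (fun k hk => (admissible_shift i k).2 (hadm _ (by rw [abs_le] at hk; omega)))
      (by rw [lam_shift, add_zero]; exact lt_trans (by norm_num) hlam)
    rw [periodicAt_shift, add_zero] at this
    refine this.imp_right fun h => ?_
    have e : (fun n => A (i + -n)) = fun n => (fun n => A (-n)) (-i + n) := by
      funext n
      congr 1
      ring
    rw [e] at h
    simpa only [add_zero] using (periodicAt_shift (A := fun n => A (-n)) (-i) 0).1 h
  by_cases hP : ∃ i, N + 60 ≤ i ∧ PeriodicAt A i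
  · obtain ⟨i, hi, hP⟩ := hP
    obtain ⟨j, hj, hlam⟩ := hfreq (i + 25)
    exact absurd hlam (not_lt.2 (lam_le_of_periodicAt hA (a := N + 1) (b := j + 100)
      (fun k hk _ => hadm k hk) hP (by omega) hj le_rfl))
  · obtain ⟨j, hj, hlam⟩ := hfreq (N + 200)
    obtain ⟨i, hi, hlam'⟩ := hfreq (j + 100)
    have h := (key i (by omega) hlam').resolve_left fun h => hP ⟨i, by omega, h⟩
    have := lam_le_of_periodicAt (A := fun n => A (-n)) (fun n => hA _) (j := -j)
      (a := -i - 50) (b := -N - 1)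
      (fun k _ hk => admissible_neg hA (hadm _ (by omega))) h (by omega) (by omega) (by omega)
    rw [lam_neg hA, neg_neg] at this
    exact absurd hlam (not_lt.2 this)

theorem not_matchR_of_search {w : List ℕ} (hA : ∀ n, 0 < A n) (hR : ∀ k, Admissible A k)
    (hs : search 3118120178200 1000000000000 (fun _ _ => false) 30 true [] w = true) (s : ℤ) :
    ¬ MatchR A s w := by
  intro h
  rw [← add_zero s, ← matchR_shift] at h
  exact search_sound (A := fun n => A (s + n)) (R := w.length + 30) (P := False) (by norm_num)
    (fun n => hA _) (by simp) (fun k _ => (admissible_shift s k).2 (hR _)) (by simp)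
    le_rfl (l := []) trivial h hs

theorem not_matchR_one_two_one (hA : ∀ n, 0 < A n) (hR : ∀ k, Admissible A k) (s : ℤ) :
    ¬ MatchR A s [1,2,1] :=
  not_matchR_of_search hA hR (by decide +kernel) s

theorem not_matchR_two_one_two_two_two_one (hA : ∀ n, 0 < A n) (hR : ∀ k, Admissible A k)
    (s : ℤ) : ¬ MatchR A s [2,1,2,2,2,1] :=
  not_matchR_of_search hA hR (by decide +kernel) s

/-- Breaking the periodic pattern seventeen digits to the left of the origin gives `λ_0 ≥ f`. -/
theorem fV_le_lam_of_break (hA : ∀ n, 0 < A n) (hR : ∀ k, Admissible A k)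
    (hper : ∀ x : ℤ, -17 < x → A x = perA x) (hbreak : A (-17) = 1) : fV ≤ lam A 0 := by
  rw [← lam_leastA_zero, lam_eq hA, lam_eq leastA_pos]
  have h0 : A 0 = leastA 0 := by rw [hper 0 (by norm_num), leastA_eq_perA (by norm_num)]
  have hr : rightVal A (0 + 1) = rightVal leastA (0 + 1) := by
    unfold rightVal
    congr 1
    funext k
    rw [hper _ (by omega), leastA_eq_perA (by omega)]
  rw [h0, hr]
  suffices h : leftVal leastA (0 - 1) ≤ leftVal A (0 - 1) by linarith
  by_contra! hlt
  have hne : ∃ k : ℕ, A (0 - 1 - k) ≠ leastA (0 - 1 - k) := by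
    by_contra! hall
    refine hlt.ne ?_
    unfold leftVal
    congr 1
    funext k
    exact hall k
  classical
  obtain ⟨k, hk, hmin⟩ : ∃ k : ℕ, A (0 - 1 - k) ≠ leastA (0 - 1 - k) ∧
      ∀ i : ℕ, i < k → A (0 - 1 - i) = leastA (0 - 1 - i) :=
    ⟨Nat.find hne, Nat.find_spec hne, fun i hi => not_not.1 (Nat.find_min hne hi)⟩
  have hk17 : 17 ≤ k := by
    by_contra! hlt
    rcases lt_or_ge k 16 with h | h
    · exact hk (by rw [hper _ (by omega), leastA_eq_perA (by omega)])
    · obtain rfl : k = 16 := by omega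
      exact hk hbreak
  have hval : ∀ i : ℕ, 16 ≤ i → leastA (0 - 1 - i) = if (i - 12) % 6 < 3 then 2 else 1 := by
    intro i hi
    rw [leastA_eq_of_le (by omega)]
    congr 1
    rw [eq_iff_iff]
    omega
  have hvA : ∀ i : ℕ, 16 ≤ i → i < k → A (0 - 1 - i) = if (i - 12) % 6 < 3 then 2 else 1 :=
    fun i hi hik => (hmin i hik).trans (hval i hi)
  rcases (hR (0 - 1 - k)).1 with h1 | h1
  · have h2 : leastA (0 - 1 - k) = 2 := by
      rw [hval k (by omega), h1] at hk
      rw [hval k (by omega)]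
      split_ifs at hk ⊢ <;> simp_all
    have hlex := leftVal_lex hA leastA_pos k (s := 0 - 1) hmin (by rw [h1, h2]; norm_num)
    have hodd : Odd k := by
      by_contra ho
      exact absurd (hlex.1 (Nat.not_odd_iff_even.1 ho)) (not_le.2 hlt)
    have hmod : (k - 12) % 6 < 3 := by
      rw [hval k (by omega)] at h2
      by_contra hc
      simp [hc] at h2
    obtain ⟨t, rfl⟩ := hodd
    refine not_matchR_one_two_one hA hR (0 - 1 - (2 * t + 1 : ℕ)) ⟨h1, ?_, ?_, trivial⟩
    · have := hvA (2 * t) (by omega) (by omega)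
      rw [if_pos (by omega)] at this
      refine Eq.trans ?_ this
      congr 1
      omega
    · have := hvA (2 * t - 1) (by omega) (by omega)
      rw [if_neg (by omega)] at this
      refine Eq.trans ?_ this
      congr 1
      omega
  · have h2 : leastA (0 - 1 - k) = 1 := by
      rw [hval k (by omega), h1] at hk
      rw [hval k (by omega)]
      split_ifs at hk ⊢ <;> simp_all
    have hlex := leftVal_lex leastA_pos hA k (s := 0 - 1) (fun i hi => (hmin i hi).symm)
      (by rw [h1, h2]; norm_num)
    have heven : Even k := by
      by_contra he
      exact absurd (hlex.2 (Nat.not_even_iff_odd.1 he)) (not_le.2 hlt)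
    have hmod : ¬ (k - 12) % 6 < 3 := by
      rw [hval k (by omega)] at h2
      by_contra hc
      simp [hc] at h2
    obtain ⟨t, rfl⟩ := heven.exists_two_nsmul
    simp only [smul_eq_mul] at *
    refine not_matchR_two_one_two_two_two_one hA hR (0 - 1 - (2 * t : ℕ))
      ⟨h1, ?_, ?_, ?_, ?_, ?_, trivial⟩
    · have := hvA (2 * t - 1) (by omega) (by omega)
      rw [if_neg (by omega)] at this
      refine Eq.trans ?_ this
      congr 1
      omega
    · have := hvA (2 * t - 2) (by omega) (by omega)
      rw [if_pos (by omega)] at this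
      refine Eq.trans ?_ this
      congr 1
      omega
    · have := hvA (2 * t - 3) (by omega) (by omega)
      rw [if_pos (by omega)] at this
      refine Eq.trans ?_ this
      congr 1
      omega
    · have := hvA (2 * t - 4) (by omega) (by omega)
      rw [if_pos (by omega)] at this
      refine Eq.trans ?_ this
      congr 1
      omega
    · have := hvA (2 * t - 5) (by omega) (by omega)
      rw [if_neg (by omega)] at this
      refine Eq.trans ?_ this
      congr 1
      omega

/-- The periodic pattern cannot be broken at an odd distance less than seventeen. -/
theorem false_of_break (hA : ∀ n, 0 < A n) (hR : ∀ k, Admissible A k) {m : ℕ} (hm : m < 8)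
    (hper : ∀ x : ℤ, -(2 * m + 1) < x → A x = perA x)
    (hbreak : A (-(2 * m + 1)) ≠ perA (-(2 * m + 1))) : False := by
  have hs : ∀ m < 8, search 3118120178200 1000000000000 (fun _ _ => false) 30 true
      (winL perA (-1) (2 * m) ++ [3 - perA (-(2 * m + 1))]) (winR perA 0 16) = true := by
    decide +kernel
  have hlen : ∀ m < 8, (winL perA (-1) (2 * m)).length = 2 * m := by decide +kernel
  have hl : winL A (-1) (2 * m) = winL perA (-1) (2 * m) :=
    winL_congr fun k hk => hper _ (by omega)
  have hr : winR A 0 16 = winR perA 0 16 := winR_congr fun k hk => hper _ (by omega)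
  have hd : A (-(2 * m + 1)) = 3 - perA (-(2 * m + 1)) := by
    have h12 : ∀ m < 8, perA (-(2 * (m : ℕ) + 1)) = 1 ∨ perA (-(2 * (m : ℕ) + 1)) = 2 := by
      decide +kernel
    rcases h12 m hm with h | h <;> rcases (hR (-(2 * m + 1))).1 with h' | h' <;> omega
  refine search_sound (A := A) (R := 60) (by norm_num) hA (by simp) (fun k _ => hR k)
    (by have := hlen m hm; simp only [List.length_append, List.length_singleton]; omega)
    (by simp [winR]) (MatchL.append_singleton (hl ▸ matchL_winL A (-1) (2 * m)) ?_)
    (hr ▸ matchR_winR A 0 16) (hs m hm)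
  rw [hlen m hm, ← hd]
  congr 1
  push_cast
  ring

theorem false_of_periodicAt (hA : ∀ n, 0 < A n) (hR : ∀ k, Admissible A k)
    (hlt : ∀ k, lam A k < fV) (h0 : cInf < lam A 0) (hP : PeriodicAt A 0) : False := by
  have hper : ∀ x : ℤ, -8 ≤ x → A x = perA x := by
    intro x hx
    have := eq_perA_of_periodicAt (s := 0) (m := x.toNat) (x := x)
      (fun n _ => hP.add_mul hA (a := -50) (b := 0 + 9 * n + 50) (fun k _ _ => hR k) (by omega) n
        le_rfl) (by omega) (by omega)
    rwa [sub_zero] at this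
  by_cases hall : ∀ x, A x = perA x
  · rw [funext hall, lam_perA_zero] at h0
    exact lt_irrefl _ h0
  push Not at hall
  obtain ⟨b, hb, hmax⟩ := Int.exists_greatest_of_bdd (P := fun x => A x ≠ perA x)
    ⟨-8, fun x hx => by by_contra! h; exact hx (hper x h.le)⟩ hall
  obtain ⟨k, m, hm, hk⟩ : ∃ (k : ℤ) (m : ℕ), m ≤ 8 ∧ 9 * k - b = 2 * m + 1 := by
    rcases Int.even_or_odd (9 * (b / 9 + 1) - b) with ⟨t, ht⟩ | ⟨t, ht⟩
    · exact ⟨b / 9 + 2, (t + 4).toNat, by omega, by omega⟩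
    · exact ⟨b / 9 + 1, t.toNat, by omega, by omega⟩
  have hR' : ∀ j, Admissible (fun n => A (9 * k + n)) j := fun j => (admissible_shift _ _).2 (hR _)
  have hper' : ∀ x : ℤ, -(2 * m + 1) < x → A (9 * k + x) = perA x := by
    intro x hx
    rw [not_imp_comm.1 (hmax (9 * k + x)) (by omega)]
    exact perA_congr (by omega)
  have hbreak : A (9 * k + -(2 * m + 1)) ≠ perA (-(2 * m + 1)) := by
    rw [show 9 * k + -(2 * (m : ℤ) + 1) = b by omega]
    rwa [perA_congr (x := -(2 * (m : ℤ) + 1)) (y := b) (by omega)]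
  rcases hm.lt_or_eq with hm | rfl
  · exact false_of_break (A := fun n => A (9 * k + n)) (fun n => hA _) hR' hm hper' hbreak
  · have h1 : A (9 * k + -17) = 1 := by
      refine (hR' (-17)).1.resolve_right fun h => hbreak ?_
      simpa [show perA (-17) = 2 by decide +kernel] using h
    have := fV_le_lam_of_break (A := fun n => A (9 * k + n)) (fun n => hA _) hR'
      (fun x hx => hper' x (by simpa using hx)) h1
    rw [lam_shift] at this
    exact absurd this (not_le.2 (hlt _))

theorem fV_le_markovVal (hA : ∀ n, 0 < A n) (hbdd : BddAbove (Set.range (lam A)))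
    (h : cInf < markovVal A) : fV ≤ markovVal A := by
  by_contra! hlt
  obtain ⟨_, ⟨i, rfl⟩, hi⟩ := exists_lt_of_lt_csSup (Set.range_nonempty _) h
  have hlam : ∀ k, lam A k < fV := fun k => (le_csSup hbdd ⟨k, rfl⟩).trans_lt hlt
  have hadm : ∀ k, Admissible A k := fun k => admissible_of_lam_lt hA fun j _ =>
    (hlam j).trans (fV_le.trans_lt (by norm_num))
  have hadm' : ∀ k, Admissible (fun n => A (i + n)) k := fun k =>
    (admissible_shift _ _).2 (hadm _)
  rcases periodicAt_of_lt_lam (A := fun n => A (i + n)) (fun n => hA _) (fun k _ => hadm' k)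
    (by rw [lam_shift, add_zero]; exact le_cInf.trans_lt hi) with hP | hP
  · refine false_of_periodicAt (A := fun n => A (i + n)) (fun n => hA _) hadm' (fun k => ?_) ?_ hP
    · rw [lam_shift]
      exact hlam _
    · rwa [lam_shift, add_zero]
  · refine false_of_periodicAt (A := fun n => A (i + -n)) (fun n => hA _)
      (fun k => admissible_neg (A := fun n => A (i + n)) (fun n => hA _) (hadm' _))
      (fun k => ?_) ?_ hP
    · rw [lam_neg (A := fun n => A (i + n)) (fun n => hA _), lam_shift]
      exact hlam _
    · rwa [lam_neg (A := fun n => A (i + n)) (fun n => hA _), lam_shift, neg_zero, add_zero]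

end

/-- `f` is the smallest element of `(M \ L) ∩ (c_∞, C_∞)`. -/
theorem f_isLeast :
    IsLeast ((MarkovSpectrum \ LagrangeSpectrum) ∩ Ioo cInf CInf) fV := by
  refine ⟨⟨⟨fV_mem_markovSpectrum, fV_notMem_lagrangeSpectrum⟩, cInf_lt_fV, fV_lt_CInf⟩, ?_⟩
  rintro x ⟨⟨⟨A, hA, hbdd, rfl⟩, -⟩, hx, -⟩
  exact fV_le_markovVal hA hbdd hx
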